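/- For every natural number k ≥ 1, the determinant of the k×k integer matrix with (i,j) entry catalan(i+j) + catalan(i+j+1) (for 0 ≤ i,j ≤ k−1) equals the determinant of the k×k integer matrix M defined by M i j = 2 if i = j = 0; M i j = 3 if i = j ≥ 1; M i j = 1 if |i − j| = 1; and M i j = 0 otherwise. -/

import Mathlib

/-- The Catalan triangle (ballot numbers). -/
def ballotL (n j : ℕ) : ℤ := (Nat.choose (2 * n) (n + j) : ℤ) - Nat.choose (2 * n) (n + j + 1)

theorem choose_two_step (m r : ℕ) : (Nat.choose (m + 2) (r + 2) : ℤ)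
    = Nat.choose m r + 2 * Nat.choose m (r + 1) + Nat.choose m (r + 2) := by
  rw [Nat.choose_succ_succ' (m + 1) (r + 1), Nat.choose_succ_succ' m r,
    Nat.choose_succ_succ' m (r + 1)]
  push_cast
  ring

theorem ballotL_succ_succ (n j : ℕ) : ballotL (n + 1) (j + 1)
    = ballotL n j + 2 * ballotL n (j + 1) + ballotL n (j + 2) := by
  have h1 := choose_two_step (2 * n) (n + j)
  have h2 := choose_two_step (2 * n) (n + j + 1)
  unfold ballotL
  rw [show 2 * (n + 1) = 2 * n + 2 by ring, show n + 1 + (j + 1) = n + j + 2 by ring]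
  simp only [← Nat.add_assoc] at *
  rw [show n + j + 2 + 1 = n + j + 1 + 2 by ring, h1, h2]
  ring_nf

theorem ballotL_succ_zero (n : ℕ) : ballotL (n + 1) 0 = ballotL n 0 + ballotL n 1 := by
  rcases n with _ | n
  · simp [ballotL]
  · have h1 := choose_two_step (2 * (n + 1)) n
    have h2 := choose_two_step (2 * (n + 1)) (n + 1)
    have h3 : Nat.choose (2 * (n + 1)) n = Nat.choose (2 * (n + 1)) (n + 2) :=
      Nat.choose_symm_of_eq_add (by ring)
    unfold ballotL
    rw [show 2 * (n + 1 + 1) = 2 * (n + 1) + 2 by ring]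
    simp only [Nat.add_assoc, Nat.add_zero, Nat.reduceAdd] at *
    rw [h1, h2, h3]
    ring

theorem ballotL_self (n : ℕ) : ballotL n n = 1 := by
  unfold ballotL
  rw [← two_mul, Nat.choose_self, Nat.choose_eq_zero_of_lt (by omega)]
  simp

theorem ballotL_eq_zero {n j : ℕ} (h : n < j) : ballotL n j = 0 := by
  unfold ballotL
  rw [Nat.choose_eq_zero_of_lt (by omega), Nat.choose_eq_zero_of_lt (by omega)]
  simp

theorem ballotL_zero_right (n : ℕ) : ballotL n 0 = catalan n := by
  have h1 := succ_mul_catalan_eq_centralBinom n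
  have h2 := Nat.choose_succ_right_eq (2 * n) n
  rw [Nat.centralBinom_eq_two_mul_choose] at h1
  rw [show 2 * n - n = n by omega] at h2
  unfold ballotL
  zify at h1 h2
  have h3 : ((n : ℤ) + 1) ≠ 0 := by positivity
  apply mul_left_cancel₀ h3
  simp only [Nat.add_zero]
  linear_combination -h1 - h2

theorem ballotL_boundary (m n N : ℕ) :
    ∑ j ∈ Finset.range (N + 1), ballotL (m + 1) j * ballotL n j
      = ∑ j ∈ Finset.range (N + 1), ballotL m j * ballotL (n + 1) j
        + (ballotL m (N + 1) * ballotL n N - ballotL m N * ballotL n (N + 1)) := by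
  induction N with
  | zero => simp [ballotL_succ_zero]; ring
  | succ N ih =>
    rw [Finset.sum_range_succ, ih, Finset.sum_range_succ _ (N + 1), ballotL_succ_succ,
      ballotL_succ_succ]
    ring

theorem ballotL_gram (k m n : ℕ) (h : m < k) :
    ∑ j ∈ Finset.range k, ballotL m j * ballotL n j = catalan (m + n) := by
  induction m generalizing n with
  | zero =>
    rw [Finset.sum_eq_single 0]
    · rw [ballotL_self, Nat.zero_add, ballotL_zero_right, one_mul]
    · intro j _ hj
      rw [ballotL_eq_zero (by omega), zero_mul]
    · intro h'
      simp at h'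
      omega
  | succ m ih =>
    obtain ⟨N, rfl⟩ : ∃ N, k = N + 1 := ⟨k - 1, by omega⟩
    rw [ballotL_boundary, ih _ (by omega), ballotL_eq_zero (show m < N + 1 by omega),
      ballotL_eq_zero (show m < N by omega), show m + (n + 1) = m + 1 + n by ring]
    ring

/-- Entries of the tridiagonal matrix, indexed by naturals. -/
def triM (a b : ℕ) : ℤ :=
  if a = b then (if a = 0 then 2 else 3) else if a = b + 1 ∨ b = a + 1 then 1 else 0

theorem triM_row (k a n : ℕ) (ha : a < k) (hn : n < k) :
    ∑ b ∈ Finset.range k, triM a b * ballotL n b = ballotL n a + ballotL (n + 1) a := by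
  have hx : ∀ c, (if c ∈ Finset.range k then ballotL n c else 0) = ballotL n c := by
    intro c
    split_ifs with h
    · rfl
    · rw [ballotL_eq_zero]
      simp at h
      omega
  rcases a with _ | a
  · have : ∀ b, triM 0 b * ballotL n b
        = 2 * (if 0 = b then ballotL n b else 0) + (if 1 = b then ballotL n b else 0) := by
      intro b
      unfold triM
      split_ifs <;> first | omega | ring1 | (exfalso; simp_all; done) | (exfalso; simp_all; omega)
    simp only [this, Finset.sum_add_distrib, ← Finset.mul_sum, Finset.sum_ite_eq, hx]
    rw [ballotL_succ_zero]
    ring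
  · have : ∀ b, triM (a + 1) b * ballotL n b
        = 3 * (if a + 1 = b then ballotL n b else 0) + (if a + 2 = b then ballotL n b else 0)
          + (if a = b then ballotL n b else 0) := by
      intro b
      unfold triM
      split_ifs <;> first | omega | ring1 | (exfalso; simp_all; done) | (exfalso; simp_all; omega)
    simp only [this, Finset.sum_add_distrib, ← Finset.mul_sum, Finset.sum_ite_eq, hx]
    rw [ballotL_succ_succ]
    ring

/-- For every `k ≥ 1`, the determinant of the `k × k` matrix with `(i,j)` entry
`catalan (i+j) + catalan (i+j+1)` equals the determinant of the `k × k` tridiagonal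
matrix with diagonal entries `2` (first) and `3` (the rest), entries `1` when
`|i - j| = 1`, and `0` otherwise. -/
theorem det_catalan_hankel_sum_eq_det_tridiagonal (k : ℕ) (hk : 1 ≤ k) :
    (Matrix.of fun i j : Fin k =>
      (catalan ((i : ℕ) + (j : ℕ)) : ℤ) +
        (catalan ((i : ℕ) + (j : ℕ) + 1) : ℤ)).det
      = (Matrix.of fun i j : Fin k =>
          if i = j then (if (i : ℕ) = 0 then (2 : ℤ) else 3)
          else if (i : ℕ) = (j : ℕ) + 1 ∨ (j : ℕ) = (i : ℕ) + 1 then (1 : ℤ)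
          else 0).det := by
  have hM : (Matrix.of fun i j : Fin k =>
          if i = j then (if (i : ℕ) = 0 then (2 : ℤ) else 3)
          else if (i : ℕ) = (j : ℕ) + 1 ∨ (j : ℕ) = (i : ℕ) + 1 then (1 : ℤ)
          else 0) = Matrix.of fun i j : Fin k => triM i j := by
    ext i j
    simp [triM, Fin.ext_iff]
  rw [hM]
  set L : Matrix (Fin k) (Fin k) ℤ := Matrix.of fun i j : Fin k => ballotL i j with hL
  have hdet : L.det = 1 := by
    rw [Matrix.det_of_isLowerTriangular]
    · simp [hL, ballotL_self]
    · intro i j hij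
      exact ballotL_eq_zero (by simpa using hij)
  have hfac : (Matrix.of fun i j : Fin k =>
      (catalan ((i : ℕ) + (j : ℕ)) : ℤ) + (catalan ((i : ℕ) + (j : ℕ) + 1) : ℤ))
      = L * ((Matrix.of fun i j : Fin k => triM i j) * L.transpose) := by
    ext i j
    have h1 : ∀ a : Fin k, ((Matrix.of fun i j : Fin k => triM i j) * L.transpose) a j
        = ballotL j a + ballotL (j + 1) a := by
      intro a
      rw [← triM_row k a j a.2 j.2, Matrix.mul_apply]
      exact Fin.sum_univ_eq_sum_range (fun b => triM a b * ballotL j b) k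
    rw [Matrix.mul_apply]
    simp only [h1]
    simp only [hL, Matrix.of_apply, mul_add, Finset.sum_add_distrib]
    rw [Fin.sum_univ_eq_sum_range (fun b => ballotL i b * ballotL j b) k,
      Fin.sum_univ_eq_sum_range (fun b => ballotL i b * ballotL (j + 1) b) k,
      ballotL_gram _ _ _ i.2, ballotL_gram _ _ _ i.2, Nat.add_assoc]
  rw [hfac, Matrix.det_mul, Matrix.det_mul, Matrix.det_transpose, hdet]
  ring
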